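/- There exists a universal constant C > 0 such that the following holds for every n ≥ 2, every H > 0, and every ε, δ ∈ (0,1). Let μ be a probability measure on pairs (A, u), where A is an n×n real matrix and u = (u_1, …, u_n) is an n-tuple of unit vectors in ℝ^n, such that Σ_{i,j} |A_{ij}| ≤ H for μ-almost every (A, u), and let γ_n denote the standard Gaussian measure on ℝ^n. For every natural number m ≥ C · (H/ε)² · (log n + log(1/δ)), there is a measurable event of the m-fold product measure (μ ⊗ γ_n)^{⊗m} with probability at least 1 − δ on which the sample (A^{(1)}, u^{(1)}, Z^{(1)}), …, (A^{(m)}, u^{(m)}, Z^{(m)}) satisfies: for every s > 0, |(1/m) Σ_{k=1}^m slin_s(A^{(k)}, u^{(k)}, Z^{(k)}) − E_{(A,u,Z) ∼ μ⊗γ_n}[slin_s(A,u,Z)]| ≤ ε/2; consequently every ŝ > 0 that maximizes the empirical average s ↦ (1/m) Σ_{k=1}^m slin_s(A^{(k)}, u^{(k)}, Z^{(k)}) satisfies sup_{s>0} E_{(A,u,Z) ∼ μ⊗γ_n}[slin_s(A,u,Z)] − E_{(A,u,Z) ∼ μ⊗γ_n}[slin_ŝ(A,u,Z)] ≤ ε.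 -/

import Mathlib

open MeasureTheory ProbabilityTheory

/-- The `s`-linear rounding function `φ_s`. -/
noncomputable def phi (s y : ℝ) : ℝ := if y < -s then -1 else if y ≤ s then y / s else 1

/-- `slin_s(A, u, Z) = Σ_{i,j} A i j · φ_s(⟨u_i, Z⟩) · φ_s(⟨u_j, Z⟩)`. -/
noncomputable def slin (n : ℕ) (s : ℝ) (A : Fin n → Fin n → ℝ) (u : Fin n → Fin n → ℝ)
    (Z : Fin n → ℝ) : ℝ :=
  ∑ i, ∑ j, A i j * phi s (∑ k, u i k * Z k) * phi s (∑ k, u j k * Z k)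


/-- The sign attached to a Boolean. -/
noncomputable def sg (b : Bool) : ℝ := if b then 1 else -1

lemma sg_not (b : Bool) : sg (!b) = - sg b := by cases b <;> simp [sg]

lemma rad_levy {m : ℕ} {ι : Type*} [Fintype ι] [LinearOrder ι]
    (B : ι → Finset (Fin m)) (hB : Antitone B) (t : ℝ) :
    (Finset.univ.filter fun e : Fin m → Bool => ∃ i, t < ∑ k ∈ B i, sg (e k)).card ≤
      2 * (Finset.univ.filter fun e : Fin m → Bool => t < ∑ k, sg (e k)).card := by
  classical
  set Ei : ι → Finset (Fin m → Bool) := fun i =>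
    Finset.univ.filter fun e => t < ∑ k ∈ B i, sg (e k) ∧
      ∀ j, i < j → ∑ k ∈ B j, sg (e k) ≤ t with hEi
  set P : (Fin m → Bool) → Prop := fun e => t < ∑ k, sg (e k) with hP
  have h1 : (Finset.univ.filter fun e : Fin m → Bool => ∃ i, t < ∑ k ∈ B i, sg (e k)) ⊆
      Finset.univ.biUnion Ei := by
    intro e he
    simp only [Finset.mem_filter, Finset.mem_univ, true_and] at he
    obtain ⟨i, hi⟩ := he
    obtain ⟨i0, hi0, hmax⟩ := Finset.exists_max_image
      (Finset.univ.filter fun i => t < ∑ k ∈ B i, sg (e k)) id ⟨i, by simpa using hi⟩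
    simp only [Finset.mem_filter, Finset.mem_univ, true_and, id] at hi0 hmax
    simp only [Finset.mem_biUnion, Finset.mem_univ, true_and, hEi, Finset.mem_filter]
    refine ⟨i0, hi0, fun j hj => ?_⟩
    by_contra hc
    exact absurd (hmax j (not_le.1 hc)) (not_le.2 hj)
  have h2 : ∀ i, ((Ei i).filter fun e => ¬ P e).card ≤ ((Ei i).filter P).card := by
    intro i
    let fl : (Fin m → Bool) → (Fin m → Bool) := fun e k => if k ∈ B i then e k else !(e k)
    have hfl : ∀ e, fl (fl e) = e := by
      intro e; funext k; by_cases hk : k ∈ B i <;> simp [fl, hk]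
    have hsum : ∀ e j, i ≤ j → ∑ k ∈ B j, sg (fl e k) = ∑ k ∈ B j, sg (e k) := by
      intro e j hj
      refine Finset.sum_congr rfl fun k hk => ?_
      have : k ∈ B i := hB hj hk
      simp [fl, this]
    refine Finset.card_le_card_of_injOn fl ?_ ?_
    · intro e he
      simp only [Finset.coe_filter, Set.mem_ofPred_eq, hEi, Finset.mem_filter, Finset.mem_univ,
        true_and, hP] at he ⊢
      obtain ⟨⟨ha, hb⟩, hc⟩ := he
      refine ⟨⟨by rwa [hsum e i le_rfl], fun j hj => by rw [hsum e j hj.le]; exact hb j hj⟩, ?_⟩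
      have : ∑ k, sg (fl e k) + ∑ k, sg (e k) = 2 * ∑ k ∈ B i, sg (e k) := by
        rw [← Finset.sum_add_distrib, Finset.mul_sum, ← Finset.sum_filter_add_sum_filter_not
          Finset.univ (fun k => k ∈ B i)]
        rw [Finset.sum_eq_zero (s := Finset.univ.filter fun k => ¬ k ∈ B i), add_zero]
        · rw [show (Finset.univ.filter fun k => k ∈ B i) = B i by ext; simp]
          refine Finset.sum_congr rfl fun k hk => ?_
          simp [fl, hk]; ring
        · intro k hk
          simp only [Finset.mem_filter, Finset.mem_univ, true_and] at hk
          simp [fl, hk, sg_not]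
      linarith [not_lt.1 hc]
    · intro a _ b _ hab
      rw [← hfl a, ← hfl b, hab]
  have hdisj : ∀ i ∈ (Finset.univ : Finset ι), ∀ j ∈ (Finset.univ : Finset ι), i ≠ j →
      Disjoint ((Ei i).filter P) ((Ei j).filter P) := by
    intro i _ j _ hij
    rw [Finset.disjoint_left]
    intro e he he'
    simp only [hEi, Finset.mem_filter, Finset.mem_univ, true_and] at he he'
    rcases lt_or_gt_of_ne hij with h | h
    · linarith [he.1.2 j h, he'.1.1]
    · linarith [he'.1.2 i h, he.1.1]
  calc _ ≤ (Finset.univ.biUnion Ei).card := Finset.card_le_card h1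
    _ ≤ ∑ i, (Ei i).card := Finset.card_biUnion_le
    _ ≤ ∑ i, 2 * ((Ei i).filter P).card := by
        refine Finset.sum_le_sum fun i _ => ?_
        have := Finset.card_filter_add_card_filter_not (s := Ei i) P
        have := h2 i
        omega
    _ = 2 * (Finset.univ.biUnion fun i => (Ei i).filter P).card := by
        rw [← Finset.mul_sum, Finset.card_biUnion hdisj]
    _ ≤ _ := by
        refine Nat.mul_le_mul_left _ (Finset.card_le_card ?_)
        intro e he
        simp only [Finset.mem_biUnion, Finset.mem_filter, Finset.mem_univ, true_and] at he ⊢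
        obtain ⟨i, _, h⟩ := he
        exact h

lemma le_ciSup_fin {ι : Type*} [Finite ι] (f : ι → ℝ) (i : ι) : f i ≤ ⨆ i, f i :=
  le_ciSup (Set.finite_range f).bddAbove i

lemma rad_sum_exp (m : ℕ) (l : ℝ) :
    ∑ e : Fin m → Bool, Real.exp (l * ∑ k, sg (e k)) ≤ 2 ^ m * Real.exp (l ^ 2 * m / 2) := by
  have h : ∑ e : Fin m → Bool, Real.exp (l * ∑ k, sg (e k)) = ∏ _k : Fin m, (2 * Real.cosh l) := by
    have := Finset.prod_univ_sum (ι := Fin m) (κ := fun _ => Bool) (fun _ => Finset.univ)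
      (fun _ b => Real.exp (l * sg b))
    rw [Fintype.piFinset_univ] at this
    simp_rw [Finset.mul_sum, Real.exp_sum]
    rw [← this]
    refine Finset.prod_congr rfl fun k _ => ?_
    simp [sg, Real.cosh_eq]; ring
  rw [h, Finset.prod_const, Finset.card_univ, Fintype.card_fin, mul_pow]
  gcongr
  calc Real.cosh l ^ m ≤ (Real.exp (l ^ 2 / 2)) ^ m := by
        gcongr
        exact Real.cosh_le_exp_half_sq l
    _ = _ := by rw [← Real.exp_nat_mul]; congr 1; ring

lemma rad_sets {m : ℕ} {ι : Type*} [Fintype ι] [LinearOrder ι] [Nonempty ι]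
    (B : ι → Finset (Fin m)) (hB : Antitone B) (l : ℝ) (hl : 0 < l) :
    ∑ e : Fin m → Bool, Real.exp (l * ⨆ i, ∑ k ∈ B i, sg (e k)) ≤
      2 * (2 ^ m * Real.exp (l ^ 2 * m / 2)) := by
  refine le_trans ?_ (mul_le_mul_of_nonneg_left (rad_sum_exp m l) zero_le_two)
  have key : ∀ f : (Fin m → Bool) → ℝ, (∀ e, 0 ≤ f e) →
      ENNReal.ofReal (∑ e, f e) = ∫⁻ t in Set.Ioi 0, (Measure.count {e | t < f e}) := by
    intro f hf
    rw [← lintegral_eq_lintegral_meas_lt Measure.count (Filter.Eventually.of_forall hf)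
      (Measurable.of_discrete).aemeasurable, lintegral_count, tsum_fintype,
      ENNReal.ofReal_sum_of_nonneg fun e _ => hf e]
  have h0 : 0 ≤ 2 * ∑ e : Fin m → Bool, Real.exp (l * ∑ k, sg (e k)) := by positivity
  rw [← ENNReal.ofReal_le_ofReal_iff h0, ENNReal.ofReal_mul zero_le_two,
    key _ (fun _ => (Real.exp_pos _).le), key _ (fun _ => (Real.exp_pos _).le),
    ← lintegral_const_mul' _ _ (by simp)]
  refine setLIntegral_mono' measurableSet_Ioi fun t ht => ?_
  have ht : 0 < t := ht
  have e1 : {e : Fin m → Bool | t < Real.exp (l * ⨆ i, ∑ k ∈ B i, sg (e k))} =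
      ↑(Finset.univ.filter fun e : Fin m → Bool => ∃ i, Real.log t / l < ∑ k ∈ B i, sg (e k)) := by
    ext e
    simp only [Set.mem_ofPred_eq, Finset.coe_filter, Finset.mem_univ, true_and]
    rw [← Real.log_lt_iff_lt_exp ht, ← div_lt_iff₀' hl]
    constructor
    · exact exists_lt_of_lt_ciSup
    · rintro ⟨i, hi⟩
      exact hi.trans_le (le_ciSup_fin (fun i => ∑ k ∈ B i, sg (e k)) i)
  have e2 : {e : Fin m → Bool | t < Real.exp (l * ∑ k, sg (e k))} =
      ↑(Finset.univ.filter fun e : Fin m → Bool => Real.log t / l < ∑ k, sg (e k)) := by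
    ext e
    simp only [Set.mem_ofPred_eq, Finset.coe_filter, Finset.mem_univ, true_and]
    rw [← Real.log_lt_iff_lt_exp ht, ← div_lt_iff₀' hl]
  rw [e1, e2, Measure.count_apply_finset, Measure.count_apply_finset]
  have := rad_levy B hB (Real.log t / l)
  simp only [ENNReal.ofReal_ofNat]
  exact_mod_cast this

lemma abs_ciSup_le {ι : Type*} [Finite ι] [Nonempty ι] (f : ι → ℝ) (c : ℝ) (h : ∀ i, |f i| ≤ c) :
    |⨆ i, f i| ≤ c := by
  rw [abs_le]
  constructor
  · obtain ⟨i⟩ := ‹Nonempty ι›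
    exact (abs_le.1 (h i)).1.trans (le_ciSup_fin f i)
  · exact ciSup_le fun i => (abs_le.1 (h i)).2

lemma int_sup {Ω ι : Type*} [MeasurableSpace Ω] (P : Measure Ω) [IsFiniteMeasure P] [Finite ι]
    [Nonempty ι] (F : ι → Ω → ℝ) (hF : ∀ i, Measurable (F i)) (c : ℝ)
    (hc : ∀ i ω, |F i ω| ≤ c) : Integrable (fun ω => ⨆ i, F i ω) P :=
  Integrable.of_bound (Measurable.iSup hF).aestronglyMeasurable c
    (Filter.Eventually.of_forall fun ω => abs_ciSup_le _ c fun i => hc i ω)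

lemma int_exp_sup {Ω ι : Type*} [MeasurableSpace Ω] (P : Measure Ω) [IsFiniteMeasure P] [Finite ι]
    [Nonempty ι] (F : ι → Ω → ℝ) (hF : ∀ i, Measurable (F i)) (c : ℝ)
    (hc : ∀ i ω, |F i ω| ≤ c) (l : ℝ) (hl : 0 < l) :
    Integrable (fun ω => Real.exp (l * ⨆ i, F i ω)) P := by
  refine Integrable.of_bound ((Measurable.iSup hF).const_mul l).exp.aestronglyMeasurable
    (Real.exp (l * c)) (Filter.Eventually.of_forall fun ω => ?_)
  rw [Real.norm_eq_abs, Real.abs_exp]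
  gcongr
  exact (abs_le.1 (abs_ciSup_le _ c fun i => hc i ω)).2

/-- Jensen, in the form that is needed below. -/
lemma jensen_sup {Ω ι : Type*} [MeasurableSpace Ω] (P : Measure Ω) [IsProbabilityMeasure P]
    [Finite ι] [Nonempty ι] (F : ι → Ω → ℝ) (hF : ∀ i, Measurable (F i)) (c : ℝ)
    (hc : ∀ i ω, |F i ω| ≤ c) (l : ℝ) (hl : 0 < l) :
    Real.exp (l * ⨆ i, ∫ ω, F i ω ∂P) ≤ ∫ ω, Real.exp (l * ⨆ i, F i ω) ∂P := by
  have hs := int_sup P F hF c hc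
  have h1 : (⨆ i, ∫ ω, F i ω ∂P) ≤ ∫ ω, ⨆ i, F i ω ∂P := by
    refine ciSup_le fun i => integral_mono ?_ hs fun ω => le_ciSup_fin (fun i => F i ω) i
    exact Integrable.of_bound (hF i).aestronglyMeasurable c
      (Filter.Eventually.of_forall fun ω => hc i ω)
  calc Real.exp (l * ⨆ i, ∫ ω, F i ω ∂P) ≤ Real.exp (∫ ω, l * ⨆ i, F i ω ∂P) := by
        rw [integral_const_mul]; gcongr
    _ ≤ _ := convexOn_exp.map_integral_le Real.continuous_exp.continuousOn isClosed_univ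
        (by simp) (hs.const_mul l) (int_exp_sup P F hF c hc l hl)

lemma abs_sg (b : Bool) : |sg b| = 1 := by cases b <;> simp [sg]

lemma abs_sum_le_m {m : ℕ} (f : Fin m → ℝ) (h : ∀ k, |f k| ≤ 1) : |∑ k, f k| ≤ m := by
  calc |∑ k, f k| ≤ ∑ k, |f k| := Finset.abs_sum_le_sum_abs _ _
    _ ≤ ∑ _k : Fin m, (1 : ℝ) := Finset.sum_le_sum fun k _ => h k
    _ = m := by simp

lemma rad_mgf {m : ℕ} {ι : Type*} [Fintype ι] [LinearOrder ι] [Nonempty ι]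
    (b : ι → Fin m → ℝ) (hb0 : ∀ i k, 0 ≤ b i k) (hb1 : ∀ i k, b i k ≤ 1)
    (hb : ∀ k, Antitone fun i => b i k) (l : ℝ) (hl : 0 < l) :
    ∑ e : Fin m → Bool, Real.exp (l * ⨆ i, ∑ k, sg (e k) * b i k) ≤
      2 * (2 ^ m * Real.exp (l ^ 2 * m / 2)) := by
  set ρ : Measure ℝ := volume.restrict (Set.Ioc 0 1) with hρ
  have : IsProbabilityMeasure ρ := ⟨by simp [hρ]⟩
  set F : (Fin m → Bool) → ι → ℝ → ℝ := fun e i r =>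
    ∑ k, sg (e k) * (Set.Iio (b i k)).indicator 1 r with hF
  have hFm : ∀ e i, Measurable (F e i) := fun e i =>
    Finset.measurable_fun_sum _ fun k _ =>
      (measurable_one.indicator measurableSet_Iio).const_mul _
  have hFc : ∀ e i r, |F e i r| ≤ m := fun e i r => by
    refine abs_sum_le_m _ fun k => ?_
    rw [abs_mul, abs_sg, one_mul]
    by_cases h : r ∈ Set.Iio (b i k) <;> simp [h]
  have hFi : ∀ e i, ∫ r, F e i r ∂ρ = ∑ k, sg (e k) * b i k := by
    intro e i
    simp only [hF]
    rw [integral_finsetSum]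
    · refine Finset.sum_congr rfl fun k _ => ?_
      rw [integral_const_mul, integral_indicator_one measurableSet_Iio]
      congr 1
      rw [measureReal_def, hρ, Measure.restrict_apply measurableSet_Iio]
      have : volume (Set.Iio (b i k) ∩ Set.Ioc 0 1) = ENNReal.ofReal (b i k) := by
        apply le_antisymm
        · refine (measure_mono (t := Set.Ioo 0 (b i k)) ?_).trans (by simp)
          rintro x ⟨h1, h2⟩
          exact ⟨h2.1, h1⟩
        · have : volume (Set.Ioo 0 (b i k)) ≤ volume (Set.Iio (b i k) ∩ Set.Ioc 0 1) := by
            refine measure_mono ?_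
            rintro x ⟨h1, h2⟩
            exact ⟨h2, h1, h2.le.trans (hb1 i k)⟩
          simpa using this
      rw [this, ENNReal.toReal_ofReal (hb0 i k)]
    · intro k _
      exact ((integrable_const (1 : ℝ)).indicator measurableSet_Iio).const_mul _
  calc ∑ e : Fin m → Bool, Real.exp (l * ⨆ i, ∑ k, sg (e k) * b i k)
      ≤ ∑ e : Fin m → Bool, ∫ r, Real.exp (l * ⨆ i, F e i r) ∂ρ := by
        refine Finset.sum_le_sum fun e _ => ?_
        simp_rw [← hFi]
        exact jensen_sup ρ (F e) (hFm e) m (hFc e) l hl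
    _ = ∫ r, ∑ e : Fin m → Bool, Real.exp (l * ⨆ i, F e i r) ∂ρ := by
        rw [integral_finsetSum]
        exact fun e _ => int_exp_sup ρ (F e) (hFm e) m (hFc e) l hl
    _ ≤ ∫ r, 2 * (2 ^ m * Real.exp (l ^ 2 * m / 2)) ∂ρ := by
        refine integral_mono (integrable_finsetSum _ fun e _ =>
          int_exp_sup ρ (F e) (hFm e) m (hFc e) l hl) (integrable_const _) fun r => ?_
        have := rad_sets (fun i => Finset.univ.filter fun k => r < b i k) (by
          intro i j hij k hk
          simp only [Finset.mem_filter, Finset.mem_univ, true_and] at hk ⊢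
          exact hk.trans_le (hb k hij)) l hl
        have hconv : ∀ e i, F e i r = ∑ k ∈ Finset.univ.filter (fun k => r < b i k), sg (e k) := by
          intro e i
          simp only [hF, Finset.sum_filter]
          refine Finset.sum_congr rfl fun k _ => ?_
          by_cases h : r < b i k <;> simp [h]
        simp_rw [hconv]
        exact this
    _ = _ := by simp

lemma symm_mgf {X : Type*} [MeasurableSpace X] (ν : Measure X) [IsProbabilityMeasure ν]
    (m : ℕ) {ι : Type*} [Fintype ι] [LinearOrder ι] [Nonempty ι]
    (g : ι → X → ℝ) (hg : ∀ i, Measurable (g i)) (hg0 : ∀ i x, 0 ≤ g i x)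
    (hg1 : ∀ i x, g i x ≤ 1) (ha : ∀ x, Antitone fun i => g i x) (l : ℝ) (hl : 0 < l) :
    ∫ ω, Real.exp (l * ⨆ i, ∑ k, (g i (ω k) - ∫ x, g i x ∂ν)) ∂(Measure.pi fun _ : Fin m => ν) ≤
      2 * Real.exp (2 * l ^ 2 * m) := by
  set π : Measure (Fin m → X) := Measure.pi fun _ : Fin m => ν with hπ
  set Q : Measure (Fin m → X × X) := Measure.pi fun _ : Fin m => ν.prod ν with hQ
  have hgabs : ∀ i x, |g i x| ≤ 1 := fun i x => abs_le.2 ⟨by linarith [hg0 i x], hg1 i x⟩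
  have hgd : ∀ i x y, |g i x - g i y| ≤ 1 := fun i x y => abs_le.2
    ⟨by linarith [hg0 i x, hg1 i y], by linarith [hg0 i y, hg1 i x]⟩
  have hgint : ∀ i, Integrable (g i) ν := fun i =>
    Integrable.of_bound (hg i).aestronglyMeasurable 1 (Filter.Eventually.of_forall (hgabs i))
  have hgI : ∀ i, 0 ≤ ∫ x, g i x ∂ν ∧ ∫ x, g i x ∂ν ≤ 1 := fun i =>
    ⟨integral_nonneg (hg0 i), by
      have := integral_mono (hgint i) (integrable_const (1 : ℝ)) (hg1 i)
      simpa using this⟩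
  -- ghost sample
  have hmD : ∀ i, Measurable fun p : (Fin m → X) × (Fin m → X) =>
      ∑ k, (g i (p.1 k) - g i (p.2 k)) := fun i =>
    Finset.measurable_fun_sum _ fun k _ =>
      ((hg i).comp ((measurable_pi_apply k).comp measurable_fst)).sub
        ((hg i).comp ((measurable_pi_apply k).comp measurable_snd))
  have hcD : ∀ i (p : (Fin m → X) × (Fin m → X)),
      |∑ k, (g i (p.1 k) - g i (p.2 k))| ≤ m := fun i p => abs_sum_le_m _ fun k => hgd _ _ _
  have hintD := int_exp_sup (π.prod π) _ hmD m hcD l hl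
  have step1 : ∫ ω, Real.exp (l * ⨆ i, ∑ k, (g i (ω k) - ∫ x, g i x ∂ν)) ∂π ≤
      ∫ p, Real.exp (l * ⨆ i, ∑ k, (g i (p.1 k) - g i (p.2 k))) ∂(π.prod π) := by
    rw [integral_prod _ hintD]
    refine integral_mono ?_ hintD.integral_prod_left fun ω => ?_
    · refine int_exp_sup π (fun i ω => ∑ k, (g i (ω k) - ∫ x, g i x ∂ν)) (fun i => ?_) m ?_ l hl
      · exact Finset.measurable_fun_sum _ fun k _ =>
          ((hg i).comp (measurable_pi_apply k)).sub_const _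
      · intro i ω
        refine abs_sum_le_m _ fun k => abs_le.2 ⟨?_, ?_⟩
        · linarith [hg0 i (ω k), (hgI i).2]
        · linarith [hg1 i (ω k), (hgI i).1]
    · have := jensen_sup π (fun i ω' => ∑ k, (g i (ω k) - g i (ω' k)))
        (fun i => (hmD i).comp measurable_prodMk_left) m (fun i ω' => hcD i (ω, ω')) l hl
      refine le_trans (le_of_eq ?_) this
      congr 3
      funext i
      have hev : ∀ k : Fin m, Integrable (fun ω' : Fin m → X => g i (ω' k)) π := fun k =>
        Integrable.of_bound ((hg i).comp (measurable_pi_apply k)).aestronglyMeasurable 1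
          (Filter.Eventually.of_forall fun _ => hgabs i _)
      rw [integral_finsetSum]
      · refine Finset.sum_congr rfl fun k _ => ?_
        rw [integral_sub (integrable_const _) (hev k)]
        have : ∫ ω' : Fin m → X, g i (ω' k) ∂π = ∫ x, g i x ∂ν :=
          integral_comp_eval (μ := fun _ : Fin m => ν) (i := k) (hg i).aestronglyMeasurable
        rw [this]; simp
      · exact fun k _ => (integrable_const _).sub (hev k)
  set G : (Fin m → Bool) → ι → (Fin m → X × X) → ℝ := fun e i z =>
    ∑ k, sg (e k) * (g i (z k).1 - g i (z k).2) with hG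
  have hGm : ∀ e i, Measurable (G e i) := fun e i =>
    Finset.measurable_fun_sum _ fun k _ =>
      (((hg i).comp (measurable_fst.comp (measurable_pi_apply k))).sub
        ((hg i).comp (measurable_snd.comp (measurable_pi_apply k)))).const_mul _
  have hGc : ∀ e i z, |G e i z| ≤ m := fun e i z => abs_sum_le_m _ fun k => by
    rw [abs_mul, abs_sg, one_mul]; exact hgd _ _ _
  have step2 : ∫ p, Real.exp (l * ⨆ i, ∑ k, (g i (p.1 k) - g i (p.2 k))) ∂(π.prod π) =
      ∫ z, Real.exp (l * ⨆ i, ∑ k, (g i (z k).1 - g i (z k).2)) ∂Q := by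
    have hmp := measurePreserving_arrowProdEquivProdArrow X X (Fin m) (fun _ => ν) (fun _ => ν)
    exact (hmp.integral_comp (MeasurableEquiv.measurableEmbedding _)
      (fun p => Real.exp (l * ⨆ i, ∑ k, (g i (p.1 k) - g i (p.2 k))))).symm
  have step3 : ∀ e : Fin m → Bool,
      ∫ z, Real.exp (l * ⨆ i, ∑ k, (g i (z k).1 - g i (z k).2)) ∂Q =
      ∫ z, Real.exp (l * ⨆ i, G e i z) ∂Q := by
    intro e
    have hmp : MeasurePreserving (fun (z : Fin m → X × X) k =>
        (fun p : X × X => if e k then p else p.swap) (z k)) Q Q := by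
      refine measurePreserving_pi (f := fun k => fun p : X × X => if e k then p else p.swap)
        (fun _ => ν.prod ν) (fun _ => ν.prod ν) fun k => ?_
      cases e k
      · simpa using Measure.measurePreserving_swap
      · simpa using! MeasurePreserving.id (ν.prod ν)
    have h0 : AEStronglyMeasurable
        (fun z : Fin m → X × X => Real.exp (l * ⨆ i, ∑ k, (g i (z k).1 - g i (z k).2)))
        (Measure.map (fun (z : Fin m → X × X) k =>
        (fun p : X × X => if e k then p else p.swap) (z k)) Q) := by
      have := (((Measurable.iSup (hGm fun _ => true)).const_mul l).exp)
      simp only [hG, sg, if_true, one_mul] at this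
      exact this.aestronglyMeasurable
    have := integral_map hmp.measurable.aemeasurable h0
    rw [hmp.map_eq] at this
    rw [this]
    congr 1
    funext z
    congr 3
    funext i
    refine Finset.sum_congr rfl fun k _ => ?_
    cases h : e k <;> simp [sg, h]
  have hintG := fun e => int_exp_sup Q (G e) (hGm e) m (hGc e) l hl
  have step4 : (2 : ℝ) ^ m * ∫ z, Real.exp (l * ⨆ i, ∑ k, (g i (z k).1 - g i (z k).2)) ∂Q ≤
      2 * (2 ^ m * Real.exp (2 * l ^ 2 * m)) := by
    calc _ = ∑ e : Fin m → Bool, ∫ z, Real.exp (l * ⨆ i, G e i z) ∂Q := by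
          simp_rw [← step3]
          simp
      _ = ∫ z, ∑ e : Fin m → Bool, Real.exp (l * ⨆ i, G e i z) ∂Q := by
          rw [integral_finsetSum]; exact fun e _ => hintG e
      _ ≤ ∫ z, 2 * (2 ^ m * Real.exp (2 * l ^ 2 * m)) ∂Q := by
          refine integral_mono (integrable_finsetSum _ fun e _ => hintG e)
            (integrable_const _) fun z => ?_
          have hA := rad_mgf (fun i k => g i (z k).1) (fun _ _ => hg0 _ _) (fun _ _ => hg1 _ _)
            (fun k => ha _) (2 * l) (by positivity)
          have hB := rad_mgf (fun i k => g i (z k).2) (fun _ _ => hg0 _ _) (fun _ _ => hg1 _ _)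
            (fun k => ha _) (2 * l) (by positivity)
          have hB' : ∑ e : Fin m → Bool, Real.exp (2 * l * ⨆ i, ∑ k, sg (!(e k)) * g i (z k).2) =
              ∑ e : Fin m → Bool, Real.exp (2 * l * ⨆ i, ∑ k, sg (e k) * g i (z k).2) := by
            exact Equiv.sum_comp (Equiv.piCongrRight fun _ : Fin m => Equiv.boolNot)
              (fun e => Real.exp (2 * l * ⨆ i, ∑ k, sg (e k) * g i (z k).2))
          rw [← hB'] at hB
          have hE : (2 * l) ^ 2 * m / 2 = 2 * l ^ 2 * (m : ℝ) := by ring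
          rw [hE] at hA hB
          have : ∑ e : Fin m → Bool, Real.exp (l * ⨆ i, G e i z) ≤
              ∑ e : Fin m → Bool, (Real.exp (2 * l * ⨆ i, ∑ k, sg (e k) * g i (z k).1) +
                Real.exp (2 * l * ⨆ i, ∑ k, sg (!(e k)) * g i (z k).2)) / 2 := by
            refine Finset.sum_le_sum fun e _ => ?_
            set a := ⨆ i, ∑ k, sg (e k) * g i (z k).1 with hadef
            set b := ⨆ i, ∑ k, sg (!(e k)) * g i (z k).2 with hbdef
            have hab : ⨆ i, G e i z ≤ a + b := by
              refine ciSup_le fun i => ?_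
              have h1 := le_ciSup_fin (fun i => ∑ k, sg (e k) * g i (z k).1) i
              have h2 := le_ciSup_fin (fun i => ∑ k, sg (!(e k)) * g i (z k).2) i
              have h3 : G e i z = ∑ k, sg (e k) * g i (z k).1 +
                  ∑ k, sg (!(e k)) * g i (z k).2 := by
                simp only [hG]
                rw [← Finset.sum_add_distrib]
                refine Finset.sum_congr rfl fun k _ => ?_
                rw [sg_not]; ring
              rw [h3]
              exact add_le_add h1 h2
            calc Real.exp (l * ⨆ i, G e i z) ≤ Real.exp (l * (a + b)) := by gcongr
              _ = Real.exp (l * a) * Real.exp (l * b) := by rw [← Real.exp_add]; ring_nf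
              _ ≤ (Real.exp (2 * l * a) + Real.exp (2 * l * b)) / 2 := by
                have e1 : Real.exp (2 * l * a) = Real.exp (l * a) ^ 2 := by
                  rw [← Real.exp_nat_mul]; push_cast; ring_nf
                have e2 : Real.exp (2 * l * b) = Real.exp (l * b) ^ 2 := by
                  rw [← Real.exp_nat_mul]; push_cast; ring_nf
                rw [e1, e2]
                nlinarith [sq_nonneg (Real.exp (l * a) - Real.exp (l * b))]
          refine this.trans ?_
          rw [← Finset.sum_div, Finset.sum_add_distrib]
          linarith
      _ = _ := by simp
  have h2m : (0 : ℝ) < 2 ^ m := by positivity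
  have : ∫ z, Real.exp (l * ⨆ i, ∑ k, (g i (z k).1 - g i (z k).2)) ∂Q ≤
      2 * Real.exp (2 * l ^ 2 * m) := by
    refine le_of_mul_le_mul_left (step4.trans (le_of_eq ?_)) h2m
    ring
  linarith [step1, step2.le]

/-- One-sided DKW-type inequality for monotone families. -/
lemma dkw_one {X : Type*} [MeasurableSpace X] (ν : Measure X) [IsProbabilityMeasure ν]
    (m : ℕ) {ι : Type*} [Fintype ι] [LinearOrder ι]
    (g : ι → X → ℝ) (hg : ∀ i, Measurable (g i)) (hg0 : ∀ i x, 0 ≤ g i x)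
    (hg1 : ∀ i x, g i x ≤ 1) (ha : ∀ x, Antitone fun i => g i x) (t : ℝ) (ht : 0 < t) :
    (Measure.pi fun _ : Fin m => ν)
      {ω | ∃ i, m * t ≤ ∑ k, (g i (ω k) - ∫ x, g i x ∂ν)} ≤
      ENNReal.ofReal (2 * Real.exp (-(m * t ^ 2 / 8))) := by
  rcases isEmpty_or_nonempty ι with hι | hι
  · simp
  have hl : 0 < t / 4 := by positivity
  have h := symm_mgf ν m g hg hg0 hg1 ha (t / 4) hl
  set π : Measure (Fin m → X) := Measure.pi fun _ : Fin m => ν with hπ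
  set f : (Fin m → X) → ℝ := fun ω =>
    Real.exp (t / 4 * ⨆ i, ∑ k, (g i (ω k) - ∫ x, g i x ∂ν)) with hf
  have hgint : ∀ i, Integrable (g i) ν := fun i =>
    Integrable.of_bound (hg i).aestronglyMeasurable 1 (Filter.Eventually.of_forall fun x =>
      abs_le.2 ⟨by linarith [hg0 i x], hg1 i x⟩)
  have hgI : ∀ i, 0 ≤ ∫ x, g i x ∂ν ∧ ∫ x, g i x ∂ν ≤ 1 := fun i =>
    ⟨integral_nonneg (hg0 i), by
      have := integral_mono (hgint i) (integrable_const (1 : ℝ)) (hg1 i)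
      simpa using this⟩
  have hfi : Integrable f π := by
    refine int_exp_sup π (fun i ω => ∑ k, (g i (ω k) - ∫ x, g i x ∂ν)) (fun i => ?_) m ?_ _ hl
    · exact Finset.measurable_fun_sum _ fun k _ =>
        ((hg i).comp (measurable_pi_apply k)).sub_const _
    · intro i ω
      refine abs_sum_le_m _ fun k => abs_le.2 ⟨?_, ?_⟩
      · linarith [hg0 i (ω k), (hgI i).2]
      · linarith [hg1 i (ω k), (hgI i).1]
  have hM := mul_meas_ge_le_integral_of_nonneg (μ := π)
    (Filter.Eventually.of_forall fun ω => (Real.exp_pos _).le) hfi (Real.exp (t / 4 * (m * t)))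
  have hsub : {ω | ∃ i, m * t ≤ ∑ k, (g i (ω k) - ∫ x, g i x ∂ν)} ⊆
      {ω | Real.exp (t / 4 * (m * t)) ≤ f ω} := by
    rintro ω ⟨i, hi⟩
    have := le_ciSup_fin (fun i => ∑ k, (g i (ω k) - ∫ x, g i x ∂ν)) i
    show Real.exp (t / 4 * (m * t)) ≤ Real.exp _
    gcongr
    exact hi.trans this
  refine (measure_mono hsub).trans ?_
  rw [← ENNReal.ofReal_toReal (measure_ne_top π {ω | Real.exp (t / 4 * (m * t)) ≤ f ω})]
  refine ENNReal.ofReal_le_ofReal ?_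
  have h3 : Real.exp (t / 4 * (m * t)) * π.real {ω | Real.exp (t / 4 * (m * t)) ≤ f ω} ≤
      Real.exp (t / 4 * (m * t)) * (2 * Real.exp (-(m * t ^ 2 / 8))) := by
    refine (hM.trans h).trans (le_of_eq ?_)
    rw [mul_left_comm, ← Real.exp_add]
    congr 2
    ring
  exact le_of_mul_le_mul_left h3 (Real.exp_pos _)

lemma dkw_two {X : Type*} [MeasurableSpace X] (ν : Measure X) [IsProbabilityMeasure ν]
    (m : ℕ) {ι : Type*} [Fintype ι] [LinearOrder ι]
    (g : ι → X → ℝ) (hg : ∀ i, Measurable (g i)) (hg0 : ∀ i x, 0 ≤ g i x)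
    (hg1 : ∀ i x, g i x ≤ 1) (ha : ∀ x, Antitone fun i => g i x) (t : ℝ) (ht : 0 < t) :
    (Measure.pi fun _ : Fin m => ν)
      {ω | ∃ i, m * t ≤ |∑ k, (g i (ω k) - ∫ x, g i x ∂ν)|} ≤
      ENNReal.ofReal (4 * Real.exp (-(m * t ^ 2 / 8))) := by
  have h1 := dkw_one ν m g hg hg0 hg1 ha t ht
  have h2 := dkw_one (ι := ιᵒᵈ) ν m (fun i x => 1 - g (OrderDual.ofDual i) x)
    (fun i => (hg _).const_sub 1) (fun i x => by linarith [hg1 (OrderDual.ofDual i) x])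
    (fun i x => by linarith [hg0 (OrderDual.ofDual i) x])
    (fun x i j hij => by
      have := ha x (OrderDual.ofDual_le_ofDual.2 hij)
      simp only at this ⊢
      linarith) t ht
  have hsub : {ω : Fin m → X | ∃ i, m * t ≤ |∑ k, (g i (ω k) - ∫ x, g i x ∂ν)|} ⊆
      {ω | ∃ i, m * t ≤ ∑ k, (g i (ω k) - ∫ x, g i x ∂ν)} ∪
      {ω | ∃ i : ιᵒᵈ, m * t ≤ ∑ k, ((1 - g (OrderDual.ofDual i) (ω k)) -
        ∫ x, (1 - g (OrderDual.ofDual i) x) ∂ν)} := by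
    rintro ω ⟨i, hi⟩
    rcases le_abs.1 hi with h | h
    · exact Or.inl ⟨i, h⟩
    · refine Or.inr ⟨OrderDual.toDual i, h.trans (le_of_eq ?_)⟩
      have hgint : Integrable (g i) ν :=
        Integrable.of_bound (hg i).aestronglyMeasurable 1 (Filter.Eventually.of_forall fun x =>
          abs_le.2 ⟨by linarith [hg0 i x], hg1 i x⟩)
      rw [OrderDual.ofDual_toDual, integral_sub (integrable_const _) hgint, ← Finset.sum_neg_distrib]
      refine Finset.sum_congr rfl fun k _ => ?_
      simp
  refine (measure_mono hsub).trans ((measure_union_le _ _).trans ((add_le_add h1 h2).trans ?_))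
  rw [← ENNReal.ofReal_add (by positivity) (by positivity)]
  refine ENNReal.ofReal_le_ofReal (le_of_eq (by ring))

lemma dkw_countable {X : Type*} [MeasurableSpace X] (ν : Measure X) [IsProbabilityMeasure ν]
    (m : ℕ) {T : Type*} [Countable T] [LinearOrder T]
    (g : T → X → ℝ) (hg : ∀ i, Measurable (g i)) (hg0 : ∀ i x, 0 ≤ g i x)
    (hg1 : ∀ i x, g i x ≤ 1) (ha : ∀ x, Antitone fun i => g i x) (t : ℝ) (ht : 0 < t) :
    (Measure.pi fun _ : Fin m => ν)
      {ω | ∃ i, m * t ≤ |∑ k, (g i (ω k) - ∫ x, g i x ∂ν)|} ≤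
      ENNReal.ofReal (4 * Real.exp (-(m * t ^ 2 / 8))) := by
  have h : {ω : Fin m → X | ∃ i, m * t ≤ |∑ k, (g i (ω k) - ∫ x, g i x ∂ν)|} =
      ⋃ F : Finset T, {ω | ∃ i : F, m * t ≤ |∑ k, (g i (ω k) - ∫ x, g i x ∂ν)|} := by
    ext ω
    simp only [Set.mem_ofPred_eq, Set.mem_iUnion]
    constructor
    · rintro ⟨i, hi⟩
      exact ⟨{i}, ⟨i, by simp⟩, hi⟩
    · rintro ⟨F, i, hi⟩
      exact ⟨i, hi⟩
  rw [h, Directed.measure_iUnion]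
  · refine iSup_le fun F => ?_
    exact dkw_two ν m (fun i : F => g i) (fun i => hg i) (fun i => hg0 i) (fun i => hg1 i)
      (fun x i j hij => ha x hij) t ht
  · refine Monotone.directed_le fun F F' hF ω => ?_
    rintro ⟨i, hi⟩
    exact ⟨⟨i.1, hF i.2⟩, hi⟩

noncomputable def sgy (y : ℝ) : ℝ := if y < 0 then -1 else 1

noncomputable def hh (s y : ℝ) : ℝ := min (|y| / s) 1

lemma phi_eq (s y : ℝ) (hs : 0 < s) : phi s y = sgy y * hh s y := by
  unfold phi sgy hh
  rcases lt_or_ge y 0 with h | h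
  · rw [abs_of_neg h, if_pos h]
    split_ifs with h1 h2
    · rw [min_eq_right]; · ring
      rw [le_div_iff₀ hs]; linarith
    · rw [min_eq_left]; · ring
      rw [div_le_iff₀ hs]; linarith
    · linarith
  · rw [abs_of_nonneg h, if_neg (not_lt.2 h), if_neg (by linarith)]
    split_ifs with h2
    · rw [min_eq_left]; · ring
      rw [div_le_iff₀ hs]; linarith
    · rw [min_eq_right]; · ring
      rw [le_div_iff₀ hs]; linarith

lemma hh_nonneg (s y : ℝ) (hs : 0 < s) : 0 ≤ hh s y := le_min (by positivity) zero_le_one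
lemma hh_le_one (s y : ℝ) : hh s y ≤ 1 := min_le_right _ _
lemma hh_anti (s s' y : ℝ) (hs : 0 < s) (h : s ≤ s') : hh s' y ≤ hh s y := by
  unfold hh; gcongr
lemma abs_sgy (y : ℝ) : |sgy y| = 1 := by unfold sgy; split_ifs <;> simp
@[fun_prop] lemma measurable_sgy : Measurable sgy :=
  Measurable.ite measurableSet_Iio measurable_const measurable_const
@[fun_prop] lemma measurable_hh (s : ℝ) : Measurable (hh s) := by unfold hh; fun_prop

/-- The sample space. -/
abbrev XX (n : ℕ) := ((Fin n → Fin n → ℝ) × (Fin n → Fin n → ℝ)) × (Fin n → ℝ)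

noncomputable def yy {n : ℕ} (x : XX n) (i : Fin n) : ℝ := ∑ k, x.1.2 i k * x.2 k

@[fun_prop] lemma measurable_yy {n : ℕ} (i : Fin n) : Measurable fun x : XX n => yy x i := by
  unfold yy; fun_prop

/-- The (unnormalised) positive/negative part of `slin`. -/
noncomputable def Pq {n : ℕ} (τ s : ℝ) (x : XX n) : ℝ :=
  ∑ i, ∑ j, max (τ * (x.1.1 i j * sgy (yy x i) * sgy (yy x j))) 0 * (hh s (yy x i) * hh s (yy x j))

noncomputable def Pp {n : ℕ} (H τ s : ℝ) (x : XX n) : ℝ := min (Pq τ s x / H) 1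

lemma Pq_nonneg {n : ℕ} (τ s : ℝ) (hs : 0 < s) (x : XX n) : 0 ≤ Pq τ s x :=
  Finset.sum_nonneg fun i _ => Finset.sum_nonneg fun j _ =>
    mul_nonneg (le_max_right _ _) (mul_nonneg (hh_nonneg _ _ hs) (hh_nonneg _ _ hs))

lemma Pq_anti {n : ℕ} (τ s s' : ℝ) (hs : 0 < s) (h : s ≤ s') (x : XX n) : Pq τ s' x ≤ Pq τ s x :=
  Finset.sum_le_sum fun i _ => Finset.sum_le_sum fun j _ =>
    mul_le_mul_of_nonneg_left (mul_le_mul (hh_anti _ _ _ hs h) (hh_anti _ _ _ hs h)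
      (hh_nonneg _ _ (hs.trans_le h)) (hh_nonneg _ _ hs)) (le_max_right _ _)

lemma Pq_le {n : ℕ} (H τ s : ℝ) (hτ : |τ| = 1) (hs : 0 < s) (x : XX n)
    (hx : ∑ i, ∑ j, |x.1.1 i j| ≤ H) : Pq τ s x ≤ H := by
  refine le_trans ?_ hx
  refine Finset.sum_le_sum fun i _ => Finset.sum_le_sum fun j _ => ?_
  have h1 : max (τ * (x.1.1 i j * sgy (yy x i) * sgy (yy x j))) 0 ≤ |x.1.1 i j| := by
    refine max_le ((le_abs_self _).trans (le_of_eq ?_)) (abs_nonneg _)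
    rw [abs_mul, abs_mul, abs_mul, abs_sgy, abs_sgy, hτ]; ring
  have h2 : hh s (yy x i) * hh s (yy x j) ≤ 1 :=
    mul_le_one₀ (hh_le_one _ _) (hh_nonneg _ _ hs) (hh_le_one _ _)
  calc _ ≤ |x.1.1 i j| * 1 := mul_le_mul h1 h2
        (mul_nonneg (hh_nonneg _ _ hs) (hh_nonneg _ _ hs)) (abs_nonneg _)
    _ = _ := mul_one _

lemma measurable_Pp {n : ℕ} (H τ s : ℝ) : Measurable (Pp (n := n) H τ s) := by
  unfold Pp Pq
  fun_prop

lemma slin_eq {n : ℕ} (s : ℝ) (hs : 0 < s) (x : XX n) :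
    slin n s x.1.1 x.1.2 x.2 = Pq 1 s x - Pq (-1) s x := by
  unfold slin Pq
  rw [← Finset.sum_sub_distrib]
  refine Finset.sum_congr rfl fun i _ => ?_
  rw [← Finset.sum_sub_distrib]
  refine Finset.sum_congr rfl fun j _ => ?_
  rw [phi_eq _ _ hs, phi_eq _ _ hs]
  change _ * (sgy (yy x i) * hh s (yy x i)) * (sgy (yy x j) * hh s (yy x j)) = _
  rw [← sub_mul, one_mul, neg_one_mul]
  rw [max_zero_sub_max_neg_zero_eq_self]
  ring

lemma slin_eq' {n : ℕ} (H s : ℝ) (hH : 0 < H) (hs : 0 < s) (x : XX n)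
    (hx : ∑ i, ∑ j, |x.1.1 i j| ≤ H) :
    slin n s x.1.1 x.1.2 x.2 = H * (Pp H 1 s x - Pp H (-1) s x) := by
  rw [slin_eq s hs x]
  unfold Pp
  rw [min_eq_left, min_eq_left]
  · field_simp
  · rw [div_le_one hH]; exact Pq_le H _ s (by simp) hs x hx
  · rw [div_le_one hH]; exact Pq_le H _ s (by simp) hs x hx

lemma Pp_nonneg {n : ℕ} (H τ s : ℝ) (hH : 0 < H) (hs : 0 < s) (x : XX n) : 0 ≤ Pp H τ s x :=
  le_min (div_nonneg (Pq_nonneg τ s hs x) hH.le) zero_le_one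
lemma Pp_le_one {n : ℕ} (H τ s : ℝ) (x : XX n) : Pp H τ s x ≤ 1 := min_le_right _ _
lemma Pp_anti {n : ℕ} (H τ s s' : ℝ) (hH : 0 < H) (hs : 0 < s) (h : s ≤ s') (x : XX n) :
    Pp H τ s' x ≤ Pp H τ s x := by
  unfold Pp
  have := Pq_anti τ s s' hs h x
  gcongr

lemma Pp_int {n : ℕ} (ν : Measure (XX n)) [IsProbabilityMeasure ν] (H τ s : ℝ) (hH : 0 < H)
    (hs : 0 < s) : Integrable (Pp H τ s) ν :=
  Integrable.of_bound (measurable_Pp H τ s).aestronglyMeasurable 1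
    (Filter.Eventually.of_forall fun x => abs_le.2
      ⟨by linarith [Pp_nonneg H τ s hH hs x], Pp_le_one H τ s x⟩)

lemma slin_cont {n : ℕ} (x : XX n) :
    ContinuousOn (fun s => slin n s x.1.1 x.1.2 x.2) (Set.Ioi 0) := by
  have : ContinuousOn (fun s => Pq 1 s x - Pq (-1) s x) (Set.Ioi 0) := by
    have hc : ∀ y : ℝ, ContinuousOn (fun s => hh s y) (Set.Ioi 0) := by
      intro y
      unfold hh
      refine ContinuousOn.inf ?_ continuousOn_const
      exact continuousOn_const.div continuousOn_id fun s hs => (ne_of_gt hs)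
    have hP : ∀ τ : ℝ, ContinuousOn (fun s => Pq τ s x) (Set.Ioi 0) := by
      intro τ
      unfold Pq
      exact continuousOn_finsetSum _ fun i _ => continuousOn_finsetSum _ fun j _ =>
        continuousOn_const.mul ((hc _).mul (hc _))
    exact (hP 1).sub (hP (-1))
  exact this.congr fun s hs => slin_eq s hs x

lemma measurable_slin {n : ℕ} (s : ℝ) (hs : 0 < s) :
    Measurable (fun x : XX n => slin n s x.1.1 x.1.2 x.2) := by
  have : (fun x : XX n => slin n s x.1.1 x.1.2 x.2) = fun x => Pq 1 s x - Pq (-1) s x :=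
    funext fun x => slin_eq s hs x
  rw [this]
  unfold Pq
  fun_prop

lemma slin_abs {n : ℕ} (H s : ℝ) (hs : 0 < s) (x : XX n)
    (hx : ∑ i, ∑ j, |x.1.1 i j| ≤ H) : |slin n s x.1.1 x.1.2 x.2| ≤ H := by
  rw [slin_eq s hs x]
  have h1 := Pq_le H 1 s (by simp) hs x hx
  have h2 := Pq_le H (-1) s (by simp) hs x hx
  have h3 := Pq_nonneg 1 s hs x
  have h4 := Pq_nonneg (-1) s hs x
  exact abs_le.2 ⟨by linarith, by linarith⟩

lemma core {n : ℕ} (ν : Measure (XX n)) [IsProbabilityMeasure ν] (H ε δ : ℝ) (hH : 0 < H)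
    (hε : 0 < ε) (hδ : 0 < δ) (hν : ∀ᵐ x ∂ν, ∑ i, ∑ j, |x.1.1 i j| ≤ H) (m : ℕ) (hm : 0 < m)
    (hbig : 8 * Real.exp (-(m * (ε / (4 * H)) ^ 2 / 8)) ≤ δ) :
    ∃ E : Set (Fin m → XX n), MeasurableSet E ∧
      ENNReal.ofReal (1 - δ) ≤ (Measure.pi fun _ : Fin m => ν) E ∧
      ∀ ω ∈ E, ∀ s : ℝ, 0 < s →
        |(1 / (m : ℝ)) * ∑ k, slin n s (ω k).1.1 (ω k).1.2 (ω k).2 -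
          ∫ x, slin n s x.1.1 x.1.2 x.2 ∂ν| ≤ ε / 2 := by
  set T := {q : ℚ // 0 < q}
  have hT : ∀ q : T, (0 : ℝ) < ((q : ℚ) : ℝ) := fun q => by exact_mod_cast q.2
  set Dv : ℝ → (Fin m → XX n) → ℝ := fun s ω =>
    |(1 / (m : ℝ)) * ∑ k, slin n s (ω k).1.1 (ω k).1.2 (ω k).2 -
          ∫ x, slin n s x.1.1 x.1.2 x.2 ∂ν| with hDv
  set Gd : Set (XX n) := {x | ∑ i, ∑ j, |x.1.1 i j| ≤ H} with hGd
  have hGdm : MeasurableSet Gd := by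
    refine measurableSet_le ?_ measurable_const
    fun_prop
  set E : Set (Fin m → XX n) := {ω | (∀ k, ω k ∈ Gd) ∧ ∀ q : T, Dv ((q : ℚ) : ℝ) ω ≤ ε / 2} with hE
  have hm' : (0 : ℝ) < m := by exact_mod_cast hm
  have hEm : MeasurableSet E := by
    have : E = (⋂ k, {ω | ω k ∈ Gd}) ∩ ⋂ q : T, {ω | Dv ((q : ℚ) : ℝ) ω ≤ ε / 2} := by
      ext ω; simp [hE]
    rw [this]
    refine (MeasurableSet.iInter fun k => measurable_pi_apply k hGdm).inter
      (MeasurableSet.iInter fun q => measurableSet_le ?_ measurable_const)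
    refine Measurable.abs ?_
    refine Measurable.sub_const (Measurable.const_mul ?_ _) _
    exact Finset.measurable_fun_sum _ fun k _ =>
      (measurable_slin _ (hT q)).comp (measurable_pi_apply k)
  refine ⟨E, hEm, ?_, ?_⟩
  · set π : Measure (Fin m → XX n) := Measure.pi fun _ : Fin m => ν with hπ
    set W : ℝ → Set (Fin m → XX n) := fun τ => {ω | ∃ q : T, m * (ε / (4 * H)) ≤
      |∑ k, (Pp H τ ((q : ℚ) : ℝ) (ω k) - ∫ x, Pp H τ ((q : ℚ) : ℝ) x ∂ν)|} with hW
    have hWle : ∀ τ, π (W τ) ≤ ENNReal.ofReal (4 * Real.exp (-(m * (ε / (4 * H)) ^ 2 / 8))) := by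
      intro τ
      exact dkw_countable ν m (fun (q : T) x => Pp H τ ((q : ℚ) : ℝ) x)
        (fun q => measurable_Pp _ _ _) (fun q x => Pp_nonneg _ _ _ hH (hT q) x)
        (fun q x => Pp_le_one _ _ _ x)
        (fun x q q' hq => Pp_anti _ _ _ _ hH (hT q) (by exact_mod_cast hq) x) _ (by positivity)
    have hN : π {ω | ¬ ∀ k, ω k ∈ Gd} = 0 := by
      have : ∀ᵐ ω ∂π, ∀ k, ω k ∈ Gd := by
        rw [ae_all_iff]
        intro k
        exact (measurePreserving_eval (fun _ : Fin m => ν) k).quasiMeasurePreserving.ae hν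
      exact this
    have hsub : Eᶜ ⊆ {ω | ¬ ∀ k, ω k ∈ Gd} ∪ (W 1 ∪ W (-1)) := by
      intro ω hω
      by_cases hg : ∀ k, ω k ∈ Gd
      · right
        by_contra hc
        simp only [hW, Set.mem_union, Set.mem_ofPred_eq, not_or, not_exists, not_le] at hc
        refine hω ⟨hg, fun q => ?_⟩
        have h1 := hc.1 q
        have h2 := hc.2 q
        have hs := hT q
        set s := ((q : ℚ) : ℝ)
        have e1 : ∑ k, slin n s (ω k).1.1 (ω k).1.2 (ω k).2 =
            H * (∑ k, Pp H 1 s (ω k) - ∑ k, Pp H (-1) s (ω k)) := by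
          rw [← Finset.sum_sub_distrib, Finset.mul_sum]
          exact Finset.sum_congr rfl fun k _ => slin_eq' H s hH hs (ω k) (hg k)
        have e2 : ∫ x, slin n s x.1.1 x.1.2 x.2 ∂ν =
            H * (∫ x, Pp H 1 s x ∂ν - ∫ x, Pp H (-1) s x ∂ν) := by
          rw [← integral_sub (Pp_int ν H _ s hH hs) (Pp_int ν H _ s hH hs), ← integral_const_mul]
          refine integral_congr_ae ?_
          filter_upwards [hν] with x hx
          exact slin_eq' H s hH hs x hx
        simp only [Finset.sum_sub_distrib, Finset.sum_const, Finset.card_univ, Fintype.card_fin,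
          nsmul_eq_mul] at h1 h2
        simp only [hDv]
        rw [e1, e2]
        set a := ∑ k, Pp H 1 s (ω k)
        set b := ∑ k, Pp H (-1) s (ω k)
        set c := ∫ x, Pp H 1 s x ∂ν
        set d := ∫ x, Pp H (-1) s x ∂ν
        have e3 : 1 / (m : ℝ) * (H * (a - b)) - H * (c - d) =
            H / m * ((a - m * c) - (b - m * d)) := by
          field_simp
          ring
        rw [e3, abs_mul, abs_of_pos (by positivity : 0 < H / (m : ℝ))]
        have h3 : |(a - m * c) - (b - m * d)| ≤ 2 * (m * (ε / (4 * H))) := by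
          have := abs_sub (a - m * c) (b - m * d)
          linarith
        calc _ ≤ H / m * (2 * (m * (ε / (4 * H)))) := by gcongr
          _ = ε / 2 := by field_simp; ring
      · exact Or.inl hg
    have hc : π Eᶜ ≤ ENNReal.ofReal δ := by
      refine (measure_mono hsub).trans ((measure_union_le _ _).trans ?_)
      rw [hN, zero_add]
      refine (measure_union_le _ _).trans ((add_le_add (hWle 1) (hWle (-1))).trans ?_)
      rw [← ENNReal.ofReal_add (by positivity) (by positivity)]
      exact ENNReal.ofReal_le_ofReal (by linarith)
    have h1 := prob_compl_eq_one_sub (μ := π) hEm.compl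
    rw [compl_compl] at h1
    rw [h1, ENNReal.ofReal_sub _ hδ.le, ENNReal.ofReal_one]
    exact tsub_le_tsub_left hc 1
  · intro ω hω s hs
    have hcE : ContinuousOn (fun s => ∫ x, slin n s x.1.1 x.1.2 x.2 ∂ν) (Set.Ioi 0) := by
      refine continuousOn_of_dominated (bound := fun _ => H)
        (fun s hs => (measurable_slin s hs).aestronglyMeasurable) (fun s hs => ?_)
        (integrable_const _) (Filter.Eventually.of_forall fun x => slin_cont x)
      filter_upwards [hν] with x hx
      exact slin_abs H s hs x hx
    have hcD : ContinuousOn (fun s => Dv s ω) (Set.Ioi 0) := by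
      refine ContinuousOn.abs (ContinuousOn.sub (continuousOn_const.mul ?_) hcE)
      exact continuousOn_finsetSum _ fun k _ => slin_cont (ω k)
    have hcl : s ∈ closure (Set.Ioi (0 : ℝ) ∩ Set.range ((↑) : ℚ → ℝ)) :=
      Rat.denseRange_cast.open_subset_closure_inter isOpen_Ioi hs
    refine ContinuousWithinAt.closure_le (f := fun s => Dv s ω) hcl (g := fun _ => ε / 2)
      ((hcD s hs).mono Set.inter_subset_left) continuousWithinAt_const ?_
    rintro y ⟨hy, q, rfl⟩
    have hq : 0 < q := by
      have : (0 : ℝ) < (q : ℝ) := hy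
      exact_mod_cast this
    exact hω.2 ⟨q, hq⟩

theorem stmt_0 :
    ∃ C : ℝ, 0 < C ∧
      ∀ (n : ℕ), 2 ≤ n → ∀ (H : ℝ), 0 < H →
      ∀ (ε δ : ℝ), ε ∈ Set.Ioo (0 : ℝ) 1 → δ ∈ Set.Ioo (0 : ℝ) 1 →
      ∀ (μ : Measure ((Fin n → Fin n → ℝ) × (Fin n → Fin n → ℝ))), IsProbabilityMeasure μ →
      (∀ᵐ x ∂μ, (∑ i, ∑ j, |x.1 i j| ≤ H) ∧ ∀ i, ∑ k, (x.2 i k) ^ 2 = 1) →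
      ∀ (m : ℕ),
        C * (H / ε) ^ 2 * (Real.log n + Real.log (1 / δ)) ≤ (m : ℝ) →
        ∃ E : Set (Fin m → ((Fin n → Fin n → ℝ) × (Fin n → Fin n → ℝ)) × (Fin n → ℝ)),
          MeasurableSet E ∧
          ENNReal.ofReal (1 - δ) ≤
            (Measure.pi fun _ : Fin m =>
              μ.prod (Measure.pi fun _ : Fin n => gaussianReal 0 1)) E ∧
          ∀ ω ∈ E,
            (∀ s : ℝ, 0 < s →
              |(1 / (m : ℝ)) * ∑ k, slin n s (ω k).1.1 (ω k).1.2 (ω k).2 -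
                ∫ x, slin n s x.1.1 x.1.2 x.2
                  ∂(μ.prod (Measure.pi fun _ : Fin n => gaussianReal 0 1))| ≤ ε / 2) ∧
            (∀ sh : ℝ, 0 < sh →
              (∀ s : ℝ, 0 < s →
                (1 / (m : ℝ)) * ∑ k, slin n s (ω k).1.1 (ω k).1.2 (ω k).2 ≤
                  (1 / (m : ℝ)) * ∑ k, slin n sh (ω k).1.1 (ω k).1.2 (ω k).2) →
              ∀ s : ℝ, 0 < s →
                (∫ x, slin n s x.1.1 x.1.2 x.2
                    ∂(μ.prod (Measure.pi fun _ : Fin n => gaussianReal 0 1))) -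
                  (∫ x, slin n sh x.1.1 x.1.2 x.2
                    ∂(μ.prod (Measure.pi fun _ : Fin n => gaussianReal 0 1))) ≤ ε) := by
  refine ⟨384, by norm_num, ?_⟩
  intro n hn H hH ε δ hε hδ μ hμ hae m hm
  have hε0 := hε.1
  have hδ0 := hδ.1
  have hlog2 : Real.log 2 ≤ Real.log n := Real.log_le_log (by norm_num) (by exact_mod_cast hn)
  have hlog2' : 0 < Real.log 2 := Real.log_pos (by norm_num)
  have hlogδ : 0 < Real.log (1 / δ) := Real.log_pos (by rw [lt_div_iff₀ hδ0]; linarith [hδ.2])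
  have hpos : (0 : ℝ) < m := lt_of_lt_of_le (by positivity) hm
  have hm0 : 0 < m := by exact_mod_cast hpos
  have hbig : 8 * Real.exp (-(m * (ε / (4 * H)) ^ 2 / 8)) ≤ δ := by
    have h1 : 3 * (Real.log 2 + Real.log (1 / δ)) ≤ m * (ε / (4 * H)) ^ 2 / 8 := by
      calc 3 * (Real.log 2 + Real.log (1 / δ)) ≤ 3 * (Real.log n + Real.log (1 / δ)) := by gcongr
        _ = 384 * (H / ε) ^ 2 * (Real.log n + Real.log (1 / δ)) * (ε / (4 * H)) ^ 2 / 8 := by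
            field_simp; ring
        _ ≤ _ := by gcongr
    have h2 : Real.exp (-(m * (ε / (4 * H)) ^ 2 / 8)) ≤ δ / 8 := by
      rw [← Real.le_log_iff_exp_le (by positivity), Real.log_div hδ0.ne' (by norm_num),
        show (8 : ℝ) = 2 ^ 3 by norm_num, Real.log_pow]
      rw [one_div, Real.log_inv] at h1 hlogδ
      push_cast
      linarith
    linarith
  have hae' : ∀ᵐ x ∂(μ.prod (Measure.pi fun _ : Fin n => gaussianReal 0 1)),
      ∑ i, ∑ j, |x.1.1 i j| ≤ H := by
    have := Measure.quasiMeasurePreserving_fst (μ := μ)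
      (ν := Measure.pi fun _ : Fin n => gaussianReal 0 1)
    filter_upwards [this.ae hae] with x hx using hx.1
  obtain ⟨E, hEm, hEp, hE⟩ := core (μ.prod (Measure.pi fun _ : Fin n => gaussianReal 0 1))
    H ε δ hH hε0 hδ0 hae' m hm0 hbig
  refine ⟨E, hEm, hEp, fun ω hω => ⟨hE ω hω, ?_⟩⟩
  intro sh hsh hmax s hs
  have h1 := abs_le.1 (hE ω hω s hs)
  have h2 := abs_le.1 (hE ω hω sh hsh)
  have h3 := hmax s hs
  linarith [h1.1, h1.2, h2.1, h2.2]
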